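/- arXiv:2501.01216 — 6 statements merged into one kernel-verified Lean document; each statement's English description precedes it below -/
import Mathlib

section
/- Fix integers Q ≥ 1 and D ≥ 1 and a real p ≥ 1. With the quantile embeddings q_i = (QE_{i0}, …, QE_{i,D-1}) defined via the scaled-sigmoid generators, the following holds: for any quantile IDs i, j, k ∈ {0, …, Q−1} with j and k on the same side of i (i.e., (i−j)(i−k) ≥ 0), one has |i−j| < |i−k| if and only if ‖q_i − q_j‖_p < ‖q_i − q_k‖_p, where ‖v‖_p = (Σ_{d=0}^{D−1} |v_d|^p)^{1/p}. -/
open Finset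

/-- The sigmoid function `1/(1+e^{-x})`. -/
noncomputable def sigmoid (x : ℝ) : ℝ := 1 / (1 + Real.exp (-x))

/-- Scale factor `S_d = ⌊(1+√(1+4d))/2⌋` of embedding dimension `d`. -/
noncomputable def scaleFactor (d : ℕ) : ℕ :=
  ⌊(1 + Real.sqrt (1 + 4 * (d : ℝ))) / 2⌋₊

/-- Offset `O_d = (−4S_d³ + (4d+2)S_d)/(2S_d − 1)` of embedding dimension `d`. -/
noncomputable def offset (d : ℕ) : ℝ :=
  (-4 * (scaleFactor d : ℝ) ^ 3 + (4 * (d : ℝ) + 2) * (scaleFactor d : ℝ)) /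
    (2 * (scaleFactor d : ℝ) - 1)

/-- Quantile embedding value `QE_{id} = sigmoid(4 S_d (i/Q − 1/2) + O_d)`. -/
noncomputable def QE (Q : ℕ) (i d : ℕ) : ℝ :=
  sigmoid (4 * (scaleFactor d : ℝ) * ((i : ℝ) / (Q : ℝ) - 1 / 2) + offset d)

theorem sigmoid_strictMono : StrictMono sigmoid := by
  intro x y hxy
  unfold sigmoid
  have hexp : Real.exp (-y) < Real.exp (-x) := Real.exp_lt_exp.mpr (by linarith)
  exact one_div_lt_one_div_of_lt (by positivity) (by linarith)

theorem one_le_scaleFactor (d : ℕ) : 1 ≤ scaleFactor d := by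
  unfold scaleFactor
  rw [Nat.one_le_floor_iff]
  have hsqrt : (1 : ℝ) ≤ Real.sqrt (1 + 4 * (d : ℝ)) :=
    Real.one_le_sqrt.mpr (by linarith [Nat.cast_nonneg (α := ℝ) d])
  linarith

theorem QE_strictMono {Q : ℕ} (hQ : 1 ≤ Q) (d : ℕ) : StrictMono fun i => QE Q i d := by
  intro i j hij
  have hQpos : (0 : ℝ) < Q := by exact_mod_cast hQ
  have hS : (0 : ℝ) < scaleFactor d := by exact_mod_cast one_le_scaleFactor d
  have hdiv : (i : ℝ) / Q < (j : ℝ) / Q :=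
    div_lt_div_of_pos_right (by exact_mod_cast hij) hQpos
  apply sigmoid_strictMono
  gcongr

/-- A strictly monotone real sequence preserves the order of distances from a fixed index
to indices on the same side of it. -/
theorem StrictMono.abs_sub_lt_abs_sub {f : ℕ → ℝ} (hf : StrictMono f) {i j k : ℕ}
    (hside : 0 ≤ ((i : ℤ) - j) * ((i : ℤ) - k)) (h : |(i : ℤ) - j| < |(i : ℤ) - k|) :
    |f i - f j| < |f i - f k| := by
  have hcases : (i ≤ j ∧ j < k) ∨ (k < j ∧ j ≤ i) := by
    rcases mul_nonneg_iff.mp hside with ⟨hj, hk⟩ | ⟨hj, hk⟩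
    · rw [abs_of_nonneg hj, abs_of_nonneg hk] at h
      omega
    · rw [abs_of_nonpos hj, abs_of_nonpos hk] at h
      omega
  rcases hcases with ⟨hij, hjk⟩ | ⟨hkj, hji⟩
  · have hle := hf.monotone hij
    have hlt := hf hjk
    rw [abs_of_nonpos (by linarith), abs_of_nonpos (by linarith)]
    linarith
  · have hle := hf.monotone hji
    have hlt := hf hkj
    rw [abs_of_nonneg (by linarith), abs_of_nonneg (by linarith)]
    linarith

theorem QE_pnorm_dist_lt {Q D : ℕ} (hQ : 1 ≤ Q) (hD : 1 ≤ D) {p : ℝ} (hp : 0 < p) {i j k : ℕ}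
    (hside : 0 ≤ ((i : ℤ) - j) * ((i : ℤ) - k)) (h : |(i : ℤ) - j| < |(i : ℤ) - k|) :
    (∑ d ∈ Finset.range D, |QE Q i d - QE Q j d| ^ p) ^ (1 / p) <
      (∑ d ∈ Finset.range D, |QE Q i d - QE Q k d| ^ p) ^ (1 / p) := by
  refine Real.rpow_lt_rpow (by positivity) ?_ (by positivity)
  refine Finset.sum_lt_sum_of_nonempty (Finset.nonempty_range_iff.mpr (by omega)) fun d _ => ?_
  exact Real.rpow_lt_rpow (abs_nonneg _) ((QE_strictMono hQ d).abs_sub_lt_abs_sub hside h) hp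

/-- For quantile IDs `j, k` on the same side of `i`, the quantile ID distance `|i−j| < |i−k|`
iff the `p`-norm distance of the corresponding quantile embeddings is smaller. -/
theorem quantile_embedding_pnorm_dist_consistent
    (Q D : ℕ) (hQ : 1 ≤ Q) (hD : 1 ≤ D) (p : ℝ) (hp : 1 ≤ p)
    (i j k : ℕ) (hi : i < Q) (hj : j < Q) (hk : k < Q)
    (hside : 0 ≤ ((i : ℤ) - j) * ((i : ℤ) - k)) :
    |(i : ℤ) - j| < |(i : ℤ) - k| ↔
      (∑ d ∈ Finset.range D, |QE Q i d - QE Q j d| ^ p) ^ (1 / p) <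
        (∑ d ∈ Finset.range D, |QE Q i d - QE Q k d| ^ p) ^ (1 / p) := by
  have hp0 : 0 < p := by linarith
  refine ⟨QE_pnorm_dist_lt hQ hD hp0 hside, fun hlt => ?_⟩
  by_contra! hle
  rcases hle.lt_or_eq with hkj | hkj
  · exact lt_asymm hlt (QE_pnorm_dist_lt hQ hD hp0 (by rwa [mul_comm]) hkj)
  · have hjk : j = k := by
      rcases abs_eq_abs.mp hkj with heq | heq
      · omega
      · rw [heq] at hside
        have hzero : (i : ℤ) - j = 0 := by nlinarith
        omega
    subst hjk
    exact lt_irrefl _ hlt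
end

section
/- Fix integers Q ≥ 1 and D ≥ 1. With the quantile embeddings q_i = (QE_{i0}, …, QE_{i,D-1}) defined via the scaled-sigmoid generators, the following holds for the supremum norm: for any quantile IDs i, j, k ∈ {0, …, Q−1} with j and k on the same side of i (i.e., (i−j)(i−k) ≥ 0), one has |i−j| < |i−k| if and only if max_{0 ≤ d < D} |QE_{id} − QE_{jd}| < max_{0 ≤ d < D} |QE_{id} − QE_{kd}|. -/
open Finset

theorem scaleFactor_pos (d : ℕ) : 0 < scaleFactor d := by
  have h : 1 ≤ Real.sqrt (1 + 4 * (d : ℝ)) := by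
    rw [Real.one_le_sqrt]
    have : (0 : ℝ) ≤ d := Nat.cast_nonneg d
    linarith
  exact Nat.floor_pos.mpr (by linarith)

theorem sup'_abs_QE_sub_lt {Q : ℕ} (hQ : 1 ≤ Q) {s : Finset ℕ} (hs : s.Nonempty) {i j k : ℕ}
    (hside : 0 ≤ ((i : ℤ) - j) * ((i : ℤ) - k)) (h : |(i : ℤ) - j| < |(i : ℤ) - k|) :
    s.sup' hs (fun d => |QE Q i d - QE Q j d|) < s.sup' hs (fun d => |QE Q i d - QE Q k d|) := by
  rw [Finset.sup'_lt_iff]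
  intro d hd
  exact ((QE_strictMono hQ d).abs_sub_lt_abs_sub hside h).trans_le
    (Finset.le_sup' (fun d => |QE Q i d - QE Q k d|) hd)

/-- For quantile IDs `j, k` on the same side of `i`, the quantile ID distance `|i−j| < |i−k|`
iff the supremum-norm distance of the corresponding quantile embeddings is smaller. -/
theorem quantile_embedding_supnorm_dist_consistent
    (Q D : ℕ) (hQ : 1 ≤ Q) (hD : 1 ≤ D)
    (i j k : ℕ) (hi : i < Q) (hj : j < Q) (hk : k < Q)
    (hside : 0 ≤ ((i : ℤ) - j) * ((i : ℤ) - k)) :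
    |(i : ℤ) - j| < |(i : ℤ) - k| ↔
      (Finset.range D).sup' (Finset.nonempty_range_iff.mpr (by omega))
          (fun d => |QE Q i d - QE Q j d|) <
        (Finset.range D).sup' (Finset.nonempty_range_iff.mpr (by omega))
          (fun d => |QE Q i d - QE Q k d|) := by
  refine ⟨sup'_abs_QE_sub_lt hQ _ hside, fun h => ?_⟩
  by_contra hc
  rcases (not_lt.mp hc).lt_or_eq with hlt | heq
  · exact h.not_gt (sup'_abs_QE_sub_lt hQ _ (by rwa [mul_comm]) hlt)
  · have hjk : k = j := by
      rcases abs_eq_abs.mp heq with h' | h'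
      · omega
      · rw [h'] at hside
        have : (i : ℤ) - j = 0 := by nlinarith
        omega
    subst hjk
    exact lt_irrefl _ h
end

section
/- Let g : ℝ → ℝ be strictly monotonically increasing, let D ≥ 1 and Q ≥ 1 be integers, and for each d ∈ {0, …, D−1} let k_d > 0 and b_d ∈ ℝ. Define embeddings q_i = (g(k_0 i + b_0), …, g(k_{D−1} i + b_{D−1})) for i ∈ {0, …, Q−1}. Then for any real p ≥ 1 and any i, j, k ∈ {0, …, Q−1} with j and k on the same side of i (i.e., (i−j)(i−k) ≥ 0), one has |i−j| < |i−k| if and only if ‖q_i − q_j‖_p < ‖q_i − q_k‖_p, where ‖v‖_p = (Σ_{d=0}^{D−1} |v_d|^p)^{1/p}. -/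
open Finset

theorem le_lt_or_lt_le_of_abs_sub_lt {i j l : ℕ} (hside : 0 ≤ ((i : ℤ) - j) * ((i : ℤ) - l))
    (hlt : |(i : ℤ) - j| < |(i : ℤ) - l|) : (i ≤ j ∧ j < l) ∨ (l < j ∧ j ≤ i) := by
  rcases mul_nonneg_iff.mp hside with ⟨hj, hl⟩ | ⟨hj, hl⟩
  · rw [abs_of_nonneg hj, abs_of_nonneg hl] at hlt
    omega
  · rw [abs_of_nonpos hj, abs_of_nonpos hl] at hlt
    omega

theorem StrictMono.abs_sub_lt_abs_sub_of_same_side {h : ℕ → ℝ} (hh : StrictMono h) {i j l : ℕ}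
    (hside : 0 ≤ ((i : ℤ) - j) * ((i : ℤ) - l)) (hlt : |(i : ℤ) - j| < |(i : ℤ) - l|) :
    |h i - h j| < |h i - h l| := by
  rcases le_lt_or_lt_le_of_abs_sub_lt hside hlt with ⟨hij, hjl⟩ | ⟨hlj, hji⟩
  · have h₁ := hh.monotone hij
    have h₂ := hh hjl
    rw [abs_of_nonpos (by linarith), abs_of_nonpos (by linarith)]
    linarith
  · have h₁ := hh.monotone hji
    have h₂ := hh hlj
    rw [abs_of_nonneg (by linarith), abs_of_nonneg (by linarith)]
    linarith

theorem rpow_sum_abs_sub_lt_of_same_side {h : ℕ → ℕ → ℝ} {D : ℕ} (hD : 1 ≤ D)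
    (hh : ∀ d < D, StrictMono (h d)) {p : ℝ} (hp : 0 < p) {i j l : ℕ}
    (hside : 0 ≤ ((i : ℤ) - j) * ((i : ℤ) - l)) (hlt : |(i : ℤ) - j| < |(i : ℤ) - l|) :
    (∑ d ∈ Finset.range D, |h d i - h d j| ^ p) ^ (1 / p) <
      (∑ d ∈ Finset.range D, |h d i - h d l| ^ p) ^ (1 / p) := by
  refine Real.rpow_lt_rpow (Finset.sum_nonneg fun d _ => by positivity) ?_ (by positivity)
  refine Finset.sum_lt_sum_of_nonempty (Finset.nonempty_range_iff.mpr (by omega)) fun d hd => ?_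
  exact Real.rpow_lt_rpow (abs_nonneg _)
    ((hh d (Finset.mem_range.mp hd)).abs_sub_lt_abs_sub_of_same_side hside hlt) hp

/-- For embeddings generated coordinatewise by a strictly monotone core function `g` applied to
affine maps of the token ID (with positive slopes), and token IDs `j, k` on the same side of `i`,
the ID distance `|i−j| < |i−k|` iff the `p`-norm embedding distance is smaller. -/
theorem strictMono_affine_embedding_pnorm_dist_consistent
    (g : ℝ → ℝ) (hg : StrictMono g)
    (D Q : ℕ) (hD : 1 ≤ D) (hQ : 1 ≤ Q)
    (k b : ℕ → ℝ) (hkpos : ∀ d < D, 0 < k d)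
    (p : ℝ) (hp : 1 ≤ p)
    (i j l : ℕ) (hi : i < Q) (hj : j < Q) (hl : l < Q)
    (hside : 0 ≤ ((i : ℤ) - j) * ((i : ℤ) - l)) :
    |(i : ℤ) - j| < |(i : ℤ) - l| ↔
      (∑ d ∈ Finset.range D,
          |g (k d * (i : ℝ) + b d) - g (k d * (j : ℝ) + b d)| ^ p) ^ (1 / p) <
        (∑ d ∈ Finset.range D,
          |g (k d * (i : ℝ) + b d) - g (k d * (l : ℝ) + b d)| ^ p) ^ (1 / p) := by
  have hp0 : 0 < p := by linarith
  have hh : ∀ d < D, StrictMono fun n : ℕ => g (k d * (n : ℝ) + b d) := fun d hd m n hmn =>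
    hg (by
      have := mul_lt_mul_of_pos_left (Nat.cast_lt (α := ℝ).mpr hmn) (hkpos d hd)
      linarith)
  refine ⟨rpow_sum_abs_sub_lt_of_same_side hD hh hp0 hside, fun hnorm => ?_⟩
  rcases lt_trichotomy |(i : ℤ) - j| |(i : ℤ) - l| with hlt | heq | hgt
  · exact hlt
  · have hjl : j = l := by
      rcases mul_nonneg_iff.mp hside with ⟨hj', hl'⟩ | ⟨hj', hl'⟩
      · rw [abs_of_nonneg hj', abs_of_nonneg hl'] at heq
        omega
      · rw [abs_of_nonpos hj', abs_of_nonpos hl'] at heq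
        omega
    subst hjl
    exact absurd hnorm (lt_irrefl _)
  · exact absurd hnorm
      (rpow_sum_abs_sub_lt_of_same_side hD hh hp0 (by rwa [mul_comm]) hgt).not_gt
end

section
/- Let g : ℝ → ℝ be monotonically increasing (not necessarily strictly), let D ≥ 1 and Q ≥ 1 be integers, and for each d ∈ {0, …, D−1} let k_d > 0 and b_d ∈ ℝ. Define embeddings q_i = (g(k_0 i + b_0), …, g(k_{D−1} i + b_{D−1})) for i ∈ {0, …, Q−1}. Then for any real p ≥ 1 and any i, j, k ∈ {0, …, Q−1} with j and k on the same side of i (i.e., (i−j)(i−k) ≥ 0), |i−j| < |i−k| implies ‖q_i − q_j‖_p ≤ ‖q_i − q_k‖_p, where ‖v‖_p = (Σ_{d=0}^{D−1} |v_d|^p)^{1/p}. -/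
open Finset

theorem or_le_of_mul_nonneg_of_abs_sub_lt {x y z : ℤ}
    (hside : 0 ≤ (x - y) * (x - z)) (hlt : |x - y| < |x - z|) :
    (x ≤ y ∧ y ≤ z) ∨ (z ≤ y ∧ y ≤ x) := by
  rcases mul_nonneg_iff.1 hside with ⟨hy, hz⟩ | ⟨hy, hz⟩
  · rw [abs_of_nonneg hy, abs_of_nonneg hz] at hlt
    omega
  · rw [abs_of_nonpos hy, abs_of_nonpos hz] at hlt
    omega

theorem Monotone.abs_sub_le_abs_sub {f : ℝ → ℝ} (hf : Monotone f) {x y z : ℝ}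
    (h : (x ≤ y ∧ y ≤ z) ∨ (z ≤ y ∧ y ≤ x)) : |f x - f y| ≤ |f x - f z| := by
  rcases h with ⟨hxy, hyz⟩ | ⟨hzy, hyx⟩
  · rw [abs_sub_comm (f x), abs_sub_comm (f x)]
    exact abs_le_abs_of_nonneg (sub_nonneg.2 (hf hxy)) (sub_le_sub_right (hf hyz) _)
  · exact abs_le_abs_of_nonneg (sub_nonneg.2 (hf hyx)) (sub_le_sub_left (hf hzy) _)

/-- For embeddings generated coordinatewise by a (not necessarily strictly) monotone core
function `g` applied to affine maps of the token ID (with positive slopes), and token IDs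
`j, k` on the same side of `i`, the ID distance `|i−j| < |i−k|` implies the non-strict
`p`-norm embedding distance inequality. -/
theorem monotone_affine_embedding_pnorm_dist_consistent
    (g : ℝ → ℝ) (hg : Monotone g)
    (D Q : ℕ) (hD : 1 ≤ D) (hQ : 1 ≤ Q)
    (k b : ℕ → ℝ) (hkpos : ∀ d < D, 0 < k d)
    (p : ℝ) (hp : 1 ≤ p)
    (i j l : ℕ) (hi : i < Q) (hj : j < Q) (hl : l < Q)
    (hside : 0 ≤ ((i : ℤ) - j) * ((i : ℤ) - l))
    (hlt : |(i : ℤ) - j| < |(i : ℤ) - l|) :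
    (∑ d ∈ Finset.range D,
        |g (k d * (i : ℝ) + b d) - g (k d * (j : ℝ) + b d)| ^ p) ^ (1 / p) ≤
      (∑ d ∈ Finset.range D,
        |g (k d * (i : ℝ) + b d) - g (k d * (l : ℝ) + b d)| ^ p) ^ (1 / p) := by
  have hp0 : 0 ≤ p := zero_le_one.trans hp
  have hbetween : ((i : ℝ) ≤ j ∧ (j : ℝ) ≤ l) ∨ ((l : ℝ) ≤ j ∧ (j : ℝ) ≤ i) := by
    exact_mod_cast or_le_of_mul_nonneg_of_abs_sub_lt hside hlt
  refine Real.rpow_le_rpow (by positivity) (Finset.sum_le_sum fun d hd => ?_) (by positivity)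
  have hkd : 0 ≤ k d := (hkpos d (Finset.mem_range.1 hd)).le
  have hmono : Monotone fun x => g (k d * x + b d) := fun x y hxy => hg (by gcongr)
  exact Real.rpow_le_rpow (abs_nonneg _) (hmono.abs_sub_le_abs_sub hbetween) hp0
end

section
/- Let V ≥ 2 be an integer, t ∈ {1, …, V}, and let f : ℕ → ℝ be non-negative and monotonically increasing with f(0) > 0, and set w_{ti} = f(|t − i|) for i ∈ {1, …, V}. For z ∈ ℝ^V let p_i = e^{z_i}/Σ_{j=1}^V e^{z_j} be the softmax probabilities and let D(z) = Σ_{i=1}^V p_i w_{ti}. Then for any z, z* ∈ ℝ^V with L_ce(z, t) = L_ce(z*, t) and D(z) < D(z*), one has L_oce(z, t) < L_oce(z*, t). -/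
open Finset

/-- Standard cross-entropy loss `L_ce(z, t) = −log( e^{z_t} / Σ_i e^{z_i} )`. -/
noncomputable def Lce {V : ℕ} (z : Fin V → ℝ) (t : Fin V) : ℝ :=
  -Real.log (Real.exp (z t) / ∑ i, Real.exp (z i))

/-- Ordinal cross-entropy loss `L_oce(z, t) = −log( w_t e^{z_t} / Σ_i w_i e^{z_i} )`. -/
noncomputable def Loce {V : ℕ} (w : Fin V → ℝ) (z : Fin V → ℝ) (t : Fin V) : ℝ :=
  -Real.log (w t * Real.exp (z t) / ∑ i, w i * Real.exp (z i))

/-- Softmax probability `p_i = e^{z_i} / Σ_j e^{z_j}`. -/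
noncomputable def softmax {V : ℕ} (z : Fin V → ℝ) (i : Fin V) : ℝ :=
  Real.exp (z i) / ∑ j, Real.exp (z j)

/-- Softmax-weighted sum of distances to the target `D(z) = Σ_i p_i w_{ti}`. -/
noncomputable def Dsum {V : ℕ} (w : Fin V → ℝ) (z : Fin V → ℝ) : ℝ :=
  ∑ i, softmax z i * w i

theorem sum_exp_pos {V : ℕ} (z : Fin V → ℝ) (t : Fin V) : 0 < ∑ i, Real.exp (z i) :=
  sum_pos (fun i _ => Real.exp_pos (z i)) ⟨t, mem_univ t⟩

theorem Dsum_eq_div {V : ℕ} (w z : Fin V → ℝ) :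
    Dsum w z = (∑ i, w i * Real.exp (z i)) / ∑ i, Real.exp (z i) := by
  simp only [Dsum, softmax, sum_div]
  exact sum_congr rfl fun i _ => by ring

theorem Dsum_pos {V : ℕ} {w : Fin V → ℝ} (hw : ∀ i, 0 < w i) (z : Fin V → ℝ) (t : Fin V) :
    0 < Dsum w z := by
  rw [Dsum_eq_div]
  exact div_pos (sum_pos (fun i _ => mul_pos (hw i) (Real.exp_pos _)) ⟨t, mem_univ t⟩)
    (sum_exp_pos z t)

theorem Loce_eq_Lce_add_log_Dsum {V : ℕ} {w : Fin V → ℝ} (hw : ∀ i, 0 < w i)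
    (z : Fin V → ℝ) (t : Fin V) :
    Loce w z t = Lce z t + Real.log (Dsum w z) - Real.log (w t) := by
  have hS := sum_exp_pos z t
  have hD := Dsum_pos hw z t
  have hp := div_pos (Real.exp_pos (z t)) hS
  have hsum : ∑ i, w i * Real.exp (z i) = Dsum w z * ∑ i, Real.exp (z i) := by
    rw [Dsum_eq_div, div_mul_cancel₀ _ hS.ne']
  have hratio : w t * Real.exp (z t) / ∑ i, w i * Real.exp (z i)
      = w t * (Real.exp (z t) / ∑ i, Real.exp (z i)) / Dsum w z := by
    rw [hsum]
    field_simp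
  rw [Loce, Lce, hratio, Real.log_div (mul_pos (hw t) hp).ne' hD.ne',
    Real.log_mul (hw t).ne' hp.ne']
  ring

/-- With weights `w_{ti} = f(|t−i|)` for a non-negative monotonically increasing `f` with
`f 0 > 0`: if two logit vectors have equal cross-entropy loss and one has a strictly smaller
softmax-weighted distance sum, then it has strictly smaller ordinal cross-entropy loss. -/
theorem Loce_lt_of_Dsum_lt
    (V : ℕ) (hV : 2 ≤ V) (t : Fin V)
    (f : ℕ → ℝ) (hf0 : 0 < f 0) (hfnn : ∀ n, 0 ≤ f n) (hfmono : Monotone f)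
    (w : Fin V → ℝ) (hw : ∀ i : Fin V, w i = f (((t : ℤ) - (i : ℤ)).natAbs))
    (z zstar : Fin V → ℝ)
    (hce : Lce z t = Lce zstar t)
    (hD : Dsum w z < Dsum w zstar) :
    Loce w z t < Loce w zstar t := by
  have hwpos : ∀ i, 0 < w i := fun i => by
    rw [hw i]
    exact hf0.trans_le (hfmono (Nat.zero_le _))
  have hlog := Real.log_lt_log (Dsum_pos hwpos z t) hD
  rw [Loce_eq_Lce_add_log_Dsum hwpos, Loce_eq_Lce_add_log_Dsum hwpos, hce]
  linarith
end

section
/- For every positive integer s and every i ∈ {0, 1, …, 2s − 1}, letting d = s² − s + i and S_d = ⌊(1 + √(1 + 4d))/2⌋ (so that S_d = s), the offset O_d = (−4S_d³ + (4d + 2)S_d)/(2S_d − 1) equals −2s + i · (4s)/(2s − 1), i.e., the i-th of the 2s values evenly spaced from −2s to 2s; consequently O_d ∈ [−2S_d, 2S_d] for every natural number d. -/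
theorem cast_sq_sub_add (s i : ℕ) :
    ((s ^ 2 - s + i : ℕ) : ℝ) = (s : ℝ) ^ 2 - s + i := by
  have h : s ≤ s ^ 2 := Nat.le_self_pow two_ne_zero s
  push_cast [Nat.cast_sub h]
  ring

theorem scaleFactor_sq_sub_add {s i : ℕ} (hs : 0 < s) (hi : i < 2 * s) :
    scaleFactor (s ^ 2 - s + i) = s := by
  have hs' : (1 : ℝ) ≤ s := by exact_mod_cast hs
  have hi' : (i : ℝ) + 1 ≤ 2 * s := by exact_mod_cast hi
  have hi0 : (0 : ℝ) ≤ i := i.cast_nonneg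
  rw [scaleFactor, Nat.floor_eq_iff (by positivity), cast_sq_sub_add]
  constructor
  · have : 2 * (s : ℝ) - 1 ≤ √(1 + 4 * ((s : ℝ) ^ 2 - s + i)) :=
      Real.le_sqrt_of_sq_le (by nlinarith)
    linarith
  · have : √(1 + 4 * ((s : ℝ) ^ 2 - s + i)) < 2 * s + 1 :=
      (Real.sqrt_lt' (by linarith)).2 (by nlinarith)
    linarith

theorem offset_sq_sub_add {s i : ℕ} (hs : 0 < s) (hi : i < 2 * s) :
    offset (s ^ 2 - s + i) = -2 * (s : ℝ) + (i : ℝ) * (4 * (s : ℝ)) / (2 * (s : ℝ) - 1) := by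
  have hs' : (1 : ℝ) ≤ s := by exact_mod_cast hs
  have h : 2 * (s : ℝ) - 1 ≠ 0 := by linarith
  rw [offset, scaleFactor_sq_sub_add hs hi, cast_sq_sub_add]
  rw [div_eq_iff h, add_mul (-2 * (s : ℝ)), div_mul_cancel₀ _ h]
  ring

theorem exists_eq_sq_sub_add (d : ℕ) : ∃ s i : ℕ, 0 < s ∧ i < 2 * s ∧ d = s ^ 2 - s + i := by
  induction d with
  | zero => exact ⟨1, 0, by norm_num⟩
  | succ d ih =>
    obtain ⟨s, i, hs, hi, rfl⟩ := ih
    by_cases h : i + 1 < 2 * s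
    · exact ⟨s, i + 1, hs, h, rfl⟩
    · refine ⟨s + 1, 0, s.succ_pos, by omega, ?_⟩
      have h₁ : s ≤ s ^ 2 := Nat.le_self_pow two_ne_zero s
      have h₂ : (s + 1) ^ 2 = s ^ 2 + 2 * s + 1 := by ring
      omega

/-- For a positive integer `s` and `i ∈ {0, …, 2s−1}`, with `d = s² − s + i` one has
`S_d = s` and the offset `O_d` equals `−2s + i·(4s)/(2s−1)`, the `i`-th of the `2s` values
evenly spaced from `−2s` to `2s`; consequently `O_d ∈ [−2S_d, 2S_d]` for every `d`. -/
theorem offset_closed_form :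
    (∀ s : ℕ, 0 < s → ∀ i : ℕ, i < 2 * s →
      scaleFactor (s ^ 2 - s + i) = s ∧
      offset (s ^ 2 - s + i) = -2 * (s : ℝ) + (i : ℝ) * (4 * (s : ℝ)) / (2 * (s : ℝ) - 1)) ∧
    (∀ d : ℕ, -(2 * (scaleFactor d : ℝ)) ≤ offset d ∧ offset d ≤ 2 * (scaleFactor d : ℝ)) := by
  refine ⟨fun s hs i hi => ⟨scaleFactor_sq_sub_add hs hi, offset_sq_sub_add hs hi⟩, fun d => ?_⟩
  obtain ⟨s, i, hs, hi, rfl⟩ := exists_eq_sq_sub_add d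
  rw [scaleFactor_sq_sub_add hs hi, offset_sq_sub_add hs hi]
  have hs' : (1 : ℝ) ≤ s := by exact_mod_cast hs
  have hi' : (i : ℝ) + 1 ≤ 2 * s := by exact_mod_cast hi
  have h : 0 < 2 * (s : ℝ) - 1 := by linarith
  have h₀ : 0 ≤ (i : ℝ) * (4 * (s : ℝ)) / (2 * (s : ℝ) - 1) := by positivity
  have h₁ : (i : ℝ) * (4 * (s : ℝ)) / (2 * (s : ℝ) - 1) ≤ 4 * s := by
    rw [div_le_iff₀ h]
    nlinarith
  constructor <;> linarith
end
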